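/- Assume char(k) = p > 2. Let λ be a dominant weight of GL_n whose mod-p reduction r(λ) is neither 0 nor a fundamental weight ε_1+...+ε_i. Then the irreducible G(n,r)-representation L(λ, G(n,r)) equals the full induced module I(L(λ)) = R(n,r)⊗_k L(λ); i.e., I(L(λ)) is irreducible. -/

import Mathlib

open MvPolynomial
open scoped TensorProduct MatrixGroups

/-- `R(n,r) ⊗_k A`, i.e. `A[x_1,...,x_n]/(x_i^{p^r})` (with `q = p^r`). -/
abbrev Rq (A : Type) [CommRing A] (n q : ℕ) : Type :=
  MvPolynomial (Fin n) A ⧸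
    Ideal.span (Set.range fun i : Fin n => (X i : MvPolynomial (Fin n) A) ^ q)

/-- `λ_{j+1}` (with `λ_{n+1} = 0`), for a weight `λ` of `GL_n`. -/
def lamSucc (n : ℕ) (lam : Fin n → ℤ) (j : Fin n) : ℤ :=
  if h : (j : ℕ) + 1 < n then lam ⟨(j : ℕ) + 1, h⟩ else 0

/-- The coefficients `m_j` of `λ = Σ m_j(ε_1+...+ε_j)` reduced mod `p`. -/
def mcoef (p n : ℕ) (lam : Fin n → ℤ) (j : Fin n) : ℤ :=
  (lam j - lamSucc n lam j) % (p : ℤ)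

/-- The mod `p`-reduction `r(λ) ∈ X_1'(T)` of a dominant weight `λ`
(so that `λ = r(λ) + p·s(λ)`). -/
def rlam (p n : ℕ) (lam : Fin n → ℤ) (i : Fin n) : ℤ :=
  ∑ j ∈ Finset.univ.filter (fun j : Fin n => i ≤ j), mcoef p n lam j

namespace Rq

section lift

variable {n q : ℕ} {B C : Type} [CommRing B] [CommRing C] [Algebra B C]

/-- The class of the `i`-th coordinate in the truncated polynomial ring. -/
noncomputable def x (B : Type) [CommRing B] (n q : ℕ) (i : Fin n) : Rq B n q := Ideal.Quotient.mk _ (X i)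

lemma mk_X (i : Fin n) :
    (Ideal.Quotient.mk _ (X i : MvPolynomial (Fin n) B) : Rq B n q) = x B n q i := rfl

lemma x_pow (i : Fin n) : x B n q i ^ q = 0 := by
  rw [x, ← map_pow]
  exact Ideal.Quotient.eq_zero_iff_mem.2 (Ideal.subset_span ⟨i, rfl⟩)

/-- The universal property of the truncated polynomial ring. -/
noncomputable def lift (P : Fin n → C) (h : ∀ i, P i ^ q = 0) : Rq B n q →ₐ[B] C :=
  Ideal.Quotient.liftₐ _ (aeval P) (by
    intro a ha
    have : Ideal.span (Set.range fun i : Fin n => (X i : MvPolynomial (Fin n) B) ^ q) ≤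
        RingHom.ker (aeval P : MvPolynomial (Fin n) B →ₐ[B] C) := by
      rw [Ideal.span_le]
      rintro _ ⟨i, rfl⟩
      simp [RingHom.mem_ker, h]
    exact this ha)

@[simp] lemma lift_mk (P : Fin n → C) (h : ∀ i, P i ^ q = 0) (f : MvPolynomial (Fin n) B) :
    lift P h (Ideal.Quotient.mk _ f : Rq B n q) = aeval P f := rfl

@[simp] lemma lift_x (P : Fin n → C) (h : ∀ i, P i ^ q = 0) (i : Fin n) :
    (lift P h : Rq B n q →ₐ[B] C) (x B n q i) = P i := by
  rw [x, lift_mk, aeval_X]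

lemma hom_ext {f g : Rq B n q →ₐ[B] C} (h : ∀ i, f (x B n q i) = g (x B n q i)) : f = g := by
  apply Ideal.Quotient.algHom_ext
  apply MvPolynomial.algHom_ext
  exact h

/-- Mutually inverse substitutions give an automorphism. -/
noncomputable def equivOf (P Q : Fin n → Rq B n q) (hP : ∀ i, P i ^ q = 0) (hQ : ∀ i, Q i ^ q = 0)
    (hPQ : ∀ i, lift (B := B) P hP (Q i) = x B n q i)
    (hQP : ∀ i, lift (B := B) Q hQ (P i) = x B n q i) : Rq B n q ≃ₐ[B] Rq B n q :=
  AlgEquiv.ofAlgHom (lift P hP) (lift Q hQ)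
    (hom_ext fun i => by simp [hPQ]) (hom_ext fun i => by simp [hQP])

@[simp] lemma equivOf_apply (P Q : Fin n → Rq B n q) (hP hQ hPQ hQP) (f : Rq B n q) :
    equivOf P Q hP hQ hPQ hQP f = lift (B := B) P hP f := rfl

end lift

section baseChange

variable {n q : ℕ} {k B : Type} [Field k] [CommRing B] [Algebra k B]

/-- The base change map on truncated polynomial rings. -/
noncomputable def bc (k B : Type) [Field k] [CommRing B] [Algebra k B] (n q : ℕ) : Rq k n q →ₐ[k] Rq B n q :=
  lift (x B n q) x_pow

@[simp] lemma bc_x (i : Fin n) : bc k B n q (x k n q i) = x B n q i := by simp [bc]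

lemma bc_mk (P : MvPolynomial (Fin n) k) :
    bc k B n q (Ideal.Quotient.mk _ P) =
      Ideal.Quotient.mk _ (MvPolynomial.map (algebraMap k B) P) := by
  have : (bc k B n q).comp (Ideal.Quotient.mkₐ k _) =
      (Ideal.Quotient.mkₐ k _).comp (MvPolynomial.mapAlgHom (Algebra.ofId k B)) := by
    apply MvPolynomial.algHom_ext
    intro i
    simp [mk_X]
  exact DFunLike.congr_fun this P

/-- The map `R(B) → R(k)` applying a linear form `φ : B → k` to all coefficients. -/
noncomputable def coeffMap (n q : ℕ) (φ : B →ₗ[k] k) : Rq B n q →ₗ[k] Rq k n q :=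
  (TensorProduct.lid k (Rq k n q)).toLinearMap ∘ₗ φ.rTensor (Rq k n q) ∘ₗ
    ((lift (fun i => (1 : B) ⊗ₜ[k] x k n q i) (fun i => by
      rw [Algebra.TensorProduct.tmul_pow, x_pow, TensorProduct.tmul_zero]) :
        Rq B n q →ₐ[B] B ⊗[k] Rq k n q).toLinearMap.restrictScalars k)

lemma coeffMap_smul_bc (φ : B →ₗ[k] k) (b : B) (f : Rq k n q) :
    coeffMap n q φ (b • bc k B n q f) = φ b • f := by
  set L : Rq B n q →ₐ[B] B ⊗[k] Rq k n q :=
    lift (fun i => (1 : B) ⊗ₜ[k] x k n q i) (fun i => by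
      rw [Algebra.TensorProduct.tmul_pow, x_pow, TensorProduct.tmul_zero]) with hL
  have h1 : (L.restrictScalars k).comp (bc k B n q) = Algebra.TensorProduct.includeRight := by
    refine hom_ext (B := k) (C := B ⊗[k] Rq k n q) fun i => ?_
    simp [hL]
  have h2 : L (bc k B n q f) = 1 ⊗ₜ f := DFunLike.congr_fun h1 f
  have h3 : coeffMap n q φ (b • bc k B n q f) =
    TensorProduct.lid k (Rq k n q) (φ.rTensor (Rq k n q) (L (b • bc k B n q f))) := rfl
  rw [h3, map_smul, h2, TensorProduct.smul_tmul', LinearMap.rTensor_tmul, TensorProduct.lid_tmul,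
    smul_eq_mul, mul_one]

lemma span_range_bc : Submodule.span B (Set.range (bc k B n q)) = ⊤ := by
  rw [eq_top_iff]
  rintro f -
  obtain ⟨P, rfl⟩ := Ideal.Quotient.mk_surjective f
  induction P using MvPolynomial.induction_on' with
  | monomial u a =>
    have : (Ideal.Quotient.mk _ (monomial u a) : Rq B n q) =
        a • bc k B n q (Ideal.Quotient.mk _ (monomial u 1)) := by
      rw [bc_mk, map_monomial, map_one, ← Ideal.Quotient.mk_eq_mk, ← Ideal.Quotient.mk_eq_mk,
        ← Submodule.Quotient.mk_smul, smul_monomial, smul_eq_mul, mul_one]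
    rw [this]
    exact Submodule.smul_mem _ _ (Submodule.subset_span ⟨_, rfl⟩)
  | add p q hp hq =>
    rw [map_add]
    exact Submodule.add_mem _ hp hq

end baseChange

section tensor

variable {n q : ℕ} {k B V : Type} [Field k] [CommRing B] [Algebra k B] [AddCommGroup V] [Module k V]

/-- An element of `B ⊗ V` lies in `B ⊗ S` as soon as all its coefficients lie in `S`. -/
lemma mem_span_of_coeff_mem (S : Submodule k V) (y : B ⊗[k] V)
    (h : ∀ φ : B →ₗ[k] k, TensorProduct.lid k V (φ.rTensor V y) ∈ S) :
    y ∈ Submodule.span B (⇑(TensorProduct.mk k B V 1) '' (S : Set V)) := by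
  classical
  set b := Module.Basis.ofVectorSpace k B
  rw [← (TensorProduct.equivFinsuppOfBasisLeft b).symm_apply_apply y,
    TensorProduct.equivFinsuppOfBasisLeft_symm_apply]
  refine Submodule.sum_mem _ fun i _ => ?_
  rw [TensorProduct.equivFinsuppOfBasisLeft_apply]
  have : ∀ v : V, b i ⊗ₜ[k] v = b i • TensorProduct.mk k B V 1 v := fun v => by
    rw [TensorProduct.mk_apply, TensorProduct.smul_tmul', smul_eq_mul, mul_one]
  beta_reduce
  rw [this]
  exact Submodule.smul_mem _ _ (Submodule.subset_span ⟨_, h _, rfl⟩)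

variable (W : Submodule k (Rq k n q ⊗[k] V))

/-- The base change `B ⊗ W` of a subspace `W`, inside `R(B) ⊗ V`. -/
noncomputable def extend (B : Type) [CommRing B] [Algebra k B] : Submodule B (Rq B n q ⊗[k] V) :=
  Submodule.span B (⇑((bc k B n q).toLinearMap.rTensor V) '' (W : Set _))

lemma coeffMap_mem {z : Rq B n q ⊗[k] V} (hz : z ∈ extend W B) (φ : B →ₗ[k] k) :
    (coeffMap n q φ).rTensor V z ∈ W := by
  have key : ∀ (b : B) (w : Rq k n q ⊗[k] V),
      (coeffMap n q φ).rTensor V (b • (bc k B n q).toLinearMap.rTensor V w) = φ b • w := by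
    intro b w
    induction w using TensorProduct.induction_on with
    | zero => simp
    | tmul f v =>
      rw [LinearMap.rTensor_tmul, TensorProduct.smul_tmul', LinearMap.rTensor_tmul,
        AlgHom.toLinearMap_apply, coeffMap_smul_bc, TensorProduct.smul_tmul']
    | add s t hs ht => simp only [map_add, smul_add, hs, ht]
  rw [extend, ← Submodule.mem_toAddSubgroup] at hz
  rw [Submodule.mem_toAddSubgroup, Submodule.mem_span_image_iff_exists_fun] at hz
  obtain ⟨t, ht, c, rfl⟩ := hz
  rw [map_sum]
  refine Submodule.sum_mem _ fun i _ => ?_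
  rw [key]
  exact Submodule.smul_mem _ _ (ht i.2)

end tensor

/-- The data relevant to the action of automorphisms on `I(V)`: the Jacobian matrix `J` of `g`. -/
def IsJacobian {n q : ℕ} {B : Type} [CommRing B] (g : Rq B n q ≃ₐ[B] Rq B n q)
    (J : GL (Fin n) (Rq B n q)) : Prop :=
  ∃ Pg : Fin n → MvPolynomial (Fin n) B, (∀ j, Ideal.Quotient.mk _ (Pg j) = g (x B n q j)) ∧
    ∀ a b, (J : Matrix (Fin n) (Fin n) (Rq B n q)) a b = Ideal.Quotient.mk _ (pderiv a (Pg b))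

/-- Invariance of `W ⊆ I(V)` under the automorphism group, in terms of coefficients. -/
def Invariant {n q : ℕ} {k V : Type} [Field k] [AddCommGroup V] [Module k V]
    (ρ : ∀ (B : Type) [CommRing B] [Algebra k B],
      GL (Fin n) B →* ((B ⊗[k] V) ≃ₗ[B] (B ⊗[k] V)))
    (W : Submodule k (Rq k n q ⊗[k] V)) : Prop :=
  ∀ (B : Type) [CommRing B] [Algebra k B] (g : Rq B n q ≃ₐ[B] Rq B n q)
    (J : GL (Fin n) (Rq B n q)), IsJacobian g J →
    ∀ z ∈ extend W B, ∀ φ : B →ₗ[k] k,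
      (coeffMap n q φ).rTensor V
        (ρ (Rq B n q) J ((g.toLinearMap.restrictScalars k).rTensor V z)) ∈ W

section charP

variable {k C : Type} [Field k] (p r : ℕ) [Fact p.Prime] [CharP k p] [CommRing C] [Algebra k C]

include k

lemma sum_pow_eq {ι : Type} (s : Finset ι) (f : ι → C) :
    (∑ i ∈ s, f i) ^ p ^ r = ∑ i ∈ s, f i ^ p ^ r := by
  cases subsingleton_or_nontrivial C
  · exact Subsingleton.elim _ _
  · have := charP_of_injective_algebraMap (algebraMap k C).injective p
    exact sum_pow_char_pow p r s f

lemma add_pow_eq (a b : C) : (a + b) ^ p ^ r = a ^ p ^ r + b ^ p ^ r := by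
  cases subsingleton_or_nontrivial C
  · exact Subsingleton.elim _ _
  · have := charP_of_injective_algebraMap (algebraMap k C).injective p
    exact add_pow_char_pow a b p r

end charP

/-- Naturality of a family of actions on points. -/
def Natural {n : ℕ} {k V : Type} [Field k] [AddCommGroup V] [Module k V]
    (ρ : ∀ (B : Type) [CommRing B] [Algebra k B],
      GL (Fin n) B →* ((B ⊗[k] V) ≃ₗ[B] (B ⊗[k] V))) : Prop :=
  ∀ (B C : Type) [CommRing B] [Algebra k B] [CommRing C] [Algebra k C],
    ∀ (φ : B →ₐ[k] C) (M : GL (Fin n) B) (M' : GL (Fin n) C),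
      (∀ a b, (M' : Matrix (Fin n) (Fin n) C) a b = φ ((M : Matrix (Fin n) (Fin n) B) a b)) →
      ∀ x, ρ C M' (TensorProduct.map φ.toLinearMap LinearMap.id x) =
        TensorProduct.map φ.toLinearMap LinearMap.id (ρ B M x)

section linear

variable {n r p : ℕ} {k B V : Type} [Field k] [Fact p.Prime] [CharP k p] [CommRing B] [Algebra k B]
  [AddCommGroup V] [Module k V]

/-- The images of the coordinates under a linear substitution. -/
noncomputable def linSubst (q : ℕ) (M : Matrix (Fin n) (Fin n) B) (b : Fin n) : Rq B n q :=
  ∑ a, algebraMap B (Rq B n q) (M a b) * x B n q a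

include k in
lemma linSubst_pow (M : Matrix (Fin n) (Fin n) B) (b : Fin n) :
    linSubst (p ^ r) M b ^ p ^ r = 0 := by
  rw [linSubst, sum_pow_eq (k := k)]
  simp [mul_pow, x_pow]

lemma lift_linSubst {q : ℕ} (M N : Matrix (Fin n) (Fin n) B) (h : M * N = 1)
    (hM : ∀ b, linSubst q M b ^ q = 0) (i : Fin n) :
    lift (B := B) (linSubst q M) hM (linSubst q N i) = x B n q i := by
  conv_lhs => rw [linSubst]
  simp only [map_sum, map_mul, AlgHom.commutes, lift_x]
  simp only [linSubst, Finset.mul_sum]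
  rw [Finset.sum_comm]
  have : ∀ c, ∑ a, algebraMap B (Rq B n q) (N a i) *
      (algebraMap B (Rq B n q) (M c a) * x B n q c) =
      algebraMap B (Rq B n q) ((M * N) c i) * x B n q c := by
    intro c
    rw [Matrix.mul_apply, map_sum, Finset.sum_mul]
    refine Finset.sum_congr rfl fun a _ => ?_
    rw [map_mul]
    ring
  simp only [this, h, Matrix.one_apply]
  simp

variable (k) in
/-- The automorphism attached to a matrix. -/
noncomputable def linAut (p r : ℕ) [Fact p.Prime] [CharP k p] (M : GL (Fin n) B) :
    Rq B n (p ^ r) ≃ₐ[B] Rq B n (p ^ r) :=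
  equivOf (linSubst (p ^ r) M) (linSubst (p ^ r) (M⁻¹ : GL (Fin n) B))
    (linSubst_pow (k := k) _) (linSubst_pow (k := k) _)
    (lift_linSubst _ _ M.mul_inv _) (lift_linSubst _ _ M.inv_mul _)

lemma isJacobian_linAut (M : GL (Fin n) B) :
    IsJacobian (linAut k p r M)
      (Matrix.GeneralLinearGroup.map (algebraMap B (Rq B n (p ^ r))) M) := by
  refine ⟨fun b => ∑ a, C ((M : Matrix (Fin n) (Fin n) B) a b) * X a, fun j => ?_, fun a b => ?_⟩
  · simp only [linAut, equivOf_apply, lift_x, linSubst, map_sum, map_mul, mk_X]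
    rfl
  · have : pderiv a (∑ c, C ((M : Matrix (Fin n) (Fin n) B) c b) * X c) =
        C ((M : Matrix (Fin n) (Fin n) B) a b) := by
      simp [Derivation.leibniz, pderiv_X, Pi.single_apply]
    rw [this]
    rfl

lemma tmul_mem_extend {q : ℕ} {W : Submodule k (Rq k n q ⊗[k] V)} {S : Set (Rq k n q)} {v : V}
    (hv : ∀ F ∈ S, F ⊗ₜ[k] v ∈ W) {f : Rq B n q}
    (hf : f ∈ Submodule.span B (⇑(bc k B n q) '' S)) : f ⊗ₜ[k] v ∈ extend W B := by
  induction hf using Submodule.span_induction with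
  | mem f h =>
    obtain ⟨F, hF, rfl⟩ := h
    exact Submodule.subset_span ⟨_, hv F hF, rfl⟩
  | zero => simp
  | add f g _ _ hf hg => rw [TensorProduct.add_tmul]; exact Submodule.add_mem _ hf hg
  | smul b f _ hf => rw [← TensorProduct.smul_tmul']; exact Submodule.smul_mem _ _ hf

lemma coeffMap_smul_rTensor {q : ℕ} (φ : B →ₗ[k] k) (F : Rq k n q) (y : B ⊗[k] V) :
    (coeffMap n q φ).rTensor V (bc k B n q F •
      (IsScalarTower.toAlgHom k B (Rq B n q)).toLinearMap.rTensor V y) =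
    F ⊗ₜ[k] TensorProduct.lid k V (φ.rTensor V y) := by
  induction y using TensorProduct.induction_on with
  | zero => simp
  | tmul b v =>
    rw [LinearMap.rTensor_tmul, TensorProduct.smul_tmul', LinearMap.rTensor_tmul,
      AlgHom.toLinearMap_apply, IsScalarTower.coe_toAlgHom', smul_eq_mul, mul_comm,
      ← Algebra.smul_def, coeffMap_smul_bc, LinearMap.rTensor_tmul, TensorProduct.lid_tmul,
      TensorProduct.smul_tmul]
  | add s t hs ht => simp only [map_add, smul_add, hs, ht, TensorProduct.tmul_add]

variable {ρ : ∀ (B : Type) [CommRing B] [Algebra k B],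
      GL (Fin n) B →* ((B ⊗[k] V) ≃ₗ[B] (B ⊗[k] V))}

omit [Fact p.Prime] [CharP k p] in
lemma Natural.apply_one_tmul (hρ : Natural ρ) {B C : Type} [CommRing B] [Algebra k B] [CommRing C]
    [Algebra k C] (φ : B →ₐ[k] C) (M : GL (Fin n) B) (M' : GL (Fin n) C)
    (h : ∀ a b, (M' : Matrix (Fin n) (Fin n) C) a b = φ ((M : Matrix (Fin n) (Fin n) B) a b))
    (v : V) : ρ C M' (1 ⊗ₜ v) = φ.toLinearMap.rTensor V (ρ B M (1 ⊗ₜ v)) := by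
  have := hρ B C φ M M' h (1 ⊗ₜ v)
  rw [TensorProduct.map_tmul, AlgHom.toLinearMap_apply, map_one] at this
  exact this

/-- The vectors `v` with `S ⊗ v ⊆ W` form a `GL_n`-stable subspace, for suitable `S`. -/
lemma stable_of_invariant (hρ : Natural ρ) {W : Submodule k (Rq k n (p ^ r) ⊗[k] V)}
    (hW : Invariant ρ W) (S : Set (Rq k n (p ^ r)))
    (hS : ∀ (B : Type) [CommRing B] [Algebra k B] (g : Rq B n (p ^ r) ≃ₐ[B] Rq B n (p ^ r)),
      ∀ F ∈ S, g (bc k B n _ F) ∈ Submodule.span B (⇑(bc k B n (p ^ r)) '' S))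
    (U : Submodule k V) (hU : ∀ v, v ∈ U ↔ ∀ F ∈ S, F ⊗ₜ[k] v ∈ W)
    (B : Type) [CommRing B] [Algebra k B] (M : GL (Fin n) B) (w : B ⊗[k] V)
    (hw : w ∈ Submodule.span B (⇑(TensorProduct.mk k B V 1) '' (U : Set V))) :
    ρ B M w ∈ Submodule.span B (⇑(TensorProduct.mk k B V 1) '' (U : Set V)) := by
  induction hw using Submodule.span_induction with
  | zero => simp
  | add f g _ _ hf hg => rw [map_add]; exact Submodule.add_mem _ hf hg
  | smul b f _ hf => rw [map_smul]; exact Submodule.smul_mem _ _ hf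
  | mem f h =>
    obtain ⟨v, hv, rfl⟩ := h
    refine mem_span_of_coeff_mem U _ fun φ => (hU _).2 fun F hF => ?_
    have h1 := hW B (linAut k p r M) _ (isJacobian_linAut M)
      ((linAut k p r M).symm (bc k B n _ F) ⊗ₜ v)
      (tmul_mem_extend ((hU v).1 hv) (hS B _ F hF)) φ
    have h2 := hρ.apply_one_tmul (IsScalarTower.toAlgHom k B (Rq B n (p ^ r))) M
      (Matrix.GeneralLinearGroup.map (algebraMap B (Rq B n (p ^ r))) M) (fun a b => rfl) v
    rw [← coeffMap_smul_rTensor, TensorProduct.mk_apply, ← h2]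
    rw [← map_smul, TensorProduct.smul_tmul', smul_eq_mul, mul_one]
    rw [LinearMap.rTensor_tmul] at h1
    simpa using h1

end linear

lemma smul_eq {n q : ℕ} {B : Type} [CommRing B] (b : B) (f : Rq B n q) :
    b • f = algebraMap B (Rq B n q) b * f :=
  Algebra.smul_def b f

lemma neg_pow_eq_zero {C : Type} [CommRing C] {a : C} {m : ℕ} (h : a ^ m = 0) : (-a) ^ m = 0 := by
  rw [neg_pow, h, mul_zero]

section translation

variable {n r p : ℕ} {k B V : Type} [Field k] [Fact p.Prime] [CharP k p] [CommRing B] [Algebra k B]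
  [AddCommGroup V] [Module k V]

include k in
lemma translate_pow (b : Fin n → B) (hb : ∀ i, b i ^ p ^ r = 0) (i : Fin n) :
    (algebraMap B (Rq B n (p ^ r)) (b i) + x B n (p ^ r) i) ^ p ^ r = 0 := by
  rw [add_pow_eq (k := k), ← map_pow, hb, map_zero, x_pow, add_zero]

variable (k) in
/-- The automorphism translating the coordinates by nilpotent elements. -/
noncomputable def translate (p r : ℕ) [Fact p.Prime] [CharP k p] (b : Fin n → B)
    (hb : ∀ i, b i ^ p ^ r = 0) (hb' : ∀ i, (-b) i ^ p ^ r = 0) :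
    Rq B n (p ^ r) ≃ₐ[B] Rq B n (p ^ r) :=
  equivOf (fun i => algebraMap B _ (b i) + x B n _ i) (fun i => algebraMap B _ ((-b) i) + x B n _ i)
    (translate_pow (k := k) b hb) (translate_pow (k := k) (-b) hb')
    (fun i => by simp only [map_add, AlgHom.commutes, lift_x]; simp)
    (fun i => by simp only [map_add, AlgHom.commutes, lift_x]; simp)

lemma isJacobian_translate (b : Fin n → B) (hb : ∀ i, b i ^ p ^ r = 0)
    (hb' : ∀ i, (-b) i ^ p ^ r = 0) : IsJacobian (translate k p r b hb hb') 1 := by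
  refine ⟨fun i => C (b i) + X i, fun j => ?_, fun i j => ?_⟩
  · simp only [translate, equivOf_apply, lift_x, map_add, mk_X]
    rfl
  · simp only [map_add, pderiv_C, pderiv_X, zero_add, Pi.single_apply, Units.val_one,
      Matrix.one_apply]
    split_ifs <;> simp_all

/-- The linear form extracting the coefficient of a monomial. -/
lemma exists_coeff {q : ℕ} (α : Fin n → Fin q) : ∃ φ : Rq k n q →ₗ[k] k, ∀ γ : Fin n → ℕ,
    φ (∏ i, x k n q i ^ γ i) = if γ = fun i => (α i : ℕ) then 1 else 0 := by
  classical
  set I := Ideal.span (Set.range fun i : Fin n => (X i : MvPolynomial (Fin n) k) ^ q) with hI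
  have hker : I.restrictScalars k ≤
      LinearMap.ker (MvPolynomial.lcoeff k (Finsupp.equivFunOnFinite.symm fun i => (α i : ℕ))) := by
    intro P hP'
    rw [Submodule.restrictScalars_mem] at hP'
    have hI' : I = Ideal.span ((fun s => monomial s (1 : k)) ''
        Set.range fun i : Fin n => Finsupp.single i q) := by
      rw [← Set.range_comp, hI]
      congr 2
      ext1 i
      simp [X_pow_eq_monomial]
    rw [hI', mem_ideal_span_monomial_image] at hP'
    by_contra hne
    obtain ⟨_, ⟨i, rfl⟩, hi⟩ := hP' _ (mem_support_iff.2 hne)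
    have := hi i
    simp at this
    omega
  refine ⟨(I.restrictScalars k).liftQ _ hker, fun γ => ?_⟩
  have : ∏ i, x k n q i ^ γ i = Ideal.Quotient.mk I (∏ i, X i ^ γ i) := by
    rw [map_prod]
    rfl
  rw [this]
  refine ((I.restrictScalars k).liftQ_apply _ _).trans ?_
  have h2 : (∏ i, X i ^ γ i : MvPolynomial (Fin n) k) =
      monomial (Finsupp.equivFunOnFinite.symm γ) 1 := by
    rw [monomial_eq, Finsupp.prod_fintype _ _ (by simp)]
    simp
  rw [h2, lcoeff_apply, coeff_monomial]
  simp only [EmbeddingLike.apply_eq_iff_eq]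

/-- Expansion of an element of `R ⊗ V` in monomials. -/
lemma exists_expansion {q : ℕ} (w : Rq k n q ⊗[k] V) :
    ∃ c : (Fin n → Fin q) → V, w = ∑ β, (∏ i, x k n q i ^ (β i : ℕ)) ⊗ₜ[k] c β := by
  classical
  induction w using TensorProduct.induction_on with
  | zero => exact ⟨0, by simp⟩
  | add s t hs ht =>
    obtain ⟨c, hc⟩ := hs
    obtain ⟨d, hd⟩ := ht
    refine ⟨c + d, ?_⟩
    rw [hc, hd, ← Finset.sum_add_distrib]
    simp [TensorProduct.tmul_add]
  | tmul f v =>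
    obtain ⟨P, rfl⟩ := Ideal.Quotient.mk_surjective f
    induction P using MvPolynomial.induction_on' with
    | add P Q hP hQ =>
      obtain ⟨c, hc⟩ := hP
      obtain ⟨d, hd⟩ := hQ
      refine ⟨c + d, ?_⟩
      rw [map_add, TensorProduct.add_tmul, hc, hd, ← Finset.sum_add_distrib]
      simp [TensorProduct.tmul_add]
    | monomial u a =>
      have hmon : (Ideal.Quotient.mk _ (monomial u a) : Rq k n q) =
          a • ∏ i, x k n q i ^ u i := by
        rw [monomial_eq, map_mul, Finsupp.prod_fintype _ _ (by simp), map_prod, smul_eq]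
        simp only [map_pow, mk_X]
        rfl
      by_cases hu : ∀ i, u i < q
      · refine ⟨Pi.single (fun i => ⟨u i, hu i⟩) (a • v), ?_⟩
        rw [Finset.sum_eq_single (fun i => ⟨u i, hu i⟩), Pi.single_eq_same, hmon,
          TensorProduct.smul_tmul]
        · intro β _ hβ
          rw [Pi.single_eq_of_ne hβ, TensorProduct.tmul_zero]
        · simp
      · push Not at hu
        obtain ⟨i, hi⟩ := hu
        refine ⟨0, ?_⟩
        have h0 : x k n q i ^ u i = 0 := pow_eq_zero_of_le hi (x_pow i)
        rw [hmon, Finset.prod_eq_zero (Finset.mem_univ i) h0]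
        simp

lemma prod_translate {q : ℕ} (b : Fin n → B) (φ : B →ₗ[k] k) (β : Fin n → ℕ) :
    coeffMap n q φ (∏ i, (algebraMap B (Rq B n q) (b i) + x B n q i) ^ β i) =
      ∑ γ ∈ Fintype.piFinset fun i => Finset.range (β i + 1),
        φ (∏ i, b i ^ γ i) • ∏ i, (x k n q i ^ (β i - γ i) * ((β i).choose (γ i) : Rq k n q)) := by
  classical
  simp only [add_pow]
  rw [Finset.prod_univ_sum, map_sum]
  refine Finset.sum_congr rfl fun γ _ => ?_
  rw [← coeffMap_smul_bc, smul_eq, map_prod (algebraMap B _), map_prod (bc k B n q), ← Finset.prod_mul_distrib]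
  congr 1
  refine Finset.prod_congr rfl fun i _ => ?_
  simp [mul_assoc]

variable {ρ : ∀ (B : Type) [CommRing B] [Algebra k B],
      GL (Fin n) B →* ((B ⊗[k] V) ≃ₗ[B] (B ⊗[k] V))}

/-- A nonzero invariant subspace contains some `1 ⊗ u` with `u ≠ 0`. -/
lemma exists_one_tmul_mem {W : Submodule k (Rq k n (p ^ r) ⊗[k] V)} (hW : Invariant ρ W)
    (hne : W ≠ ⊥) : ∃ u : V, u ≠ 0 ∧ (1 : Rq k n (p ^ r)) ⊗ₜ[k] u ∈ W := by
  classical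
  obtain ⟨w, hwW, hw⟩ := Submodule.exists_mem_ne_zero_of_ne_bot hne
  obtain ⟨c, hc⟩ := exists_expansion w
  have hex : (Finset.univ.filter fun β => c β ≠ 0).Nonempty := by
    by_contra h
    rw [Finset.not_nonempty_iff_eq_empty, Finset.filter_eq_empty_iff] at h
    refine hw (hc.trans (Finset.sum_eq_zero fun β hβ => ?_))
    have := h hβ
    rw [not_not] at this
    rw [this, TensorProduct.tmul_zero]
  obtain ⟨α, hα, hmax⟩ := Finset.exists_max_image _ (fun β => ∑ i, (β i : ℕ)) hex
  rw [Finset.mem_filter] at hα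
  refine ⟨c α, hα.2, ?_⟩
  obtain ⟨φ, hφ⟩ := exists_coeff (k := k) α
  have hb : ∀ i, x k n (p ^ r) i ^ p ^ r = 0 := x_pow
  have hb' : ∀ i, (-x k n (p ^ r)) i ^ p ^ r = 0 := fun i => neg_pow_eq_zero (hb i)
  have key := hW (Rq k n (p ^ r)) (translate k p r _ hb hb') 1 (isJacobian_translate _ hb hb')
    _ (Submodule.subset_span ⟨w, hwW, rfl⟩) φ
  have hcomp : ∀ β : Fin n → Fin (p ^ r), c β ≠ 0 →
      coeffMap n (p ^ r) φ (∏ i, (algebraMap (Rq k n (p ^ r)) _ (x k n (p ^ r) i) +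
        x (Rq k n (p ^ r)) n (p ^ r) i) ^ (β i : ℕ)) = if β = α then 1 else 0 := by
    intro β hβ
    rw [prod_translate]
    simp only [hφ, ite_smul, one_smul, zero_smul, Finset.sum_ite_eq']
    have hle := hmax β (by simp [hβ])
    by_cases h : ∀ i, (α i : ℕ) ≤ β i
    · have hαβ : β = α := by
        have := (Finset.sum_eq_sum_iff_of_le (fun i _ => h i)).1
          (le_antisymm (Finset.sum_le_sum fun i _ => h i) hle)
        ext i
        exact (this i (Finset.mem_univ i)).symm
      subst hαβ
      simp
    · have hne : β ≠ α := fun e => h fun i => e ▸ le_rfl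
      rw [if_neg hne, if_neg]
      simpa [Fintype.mem_piFinset, Nat.lt_succ_iff] using h
  rw [map_one, hc] at key
  simp only [map_sum, LinearMap.rTensor_tmul, LinearEquiv.coe_one, id] at key
  have hg : ∀ β : Fin n → Fin (p ^ r),
      ((translate k p r _ hb hb').toLinearMap.restrictScalars k)
        ((bc k (Rq k n (p ^ r)) n (p ^ r)).toLinearMap (∏ i, x k n (p ^ r) i ^ (β i : ℕ))) =
      ∏ i, (algebraMap (Rq k n (p ^ r)) _ (x k n (p ^ r) i) +
        x (Rq k n (p ^ r)) n (p ^ r) i) ^ (β i : ℕ) := by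
    intro β
    rw [AlgHom.toLinearMap_apply, LinearMap.restrictScalars_apply, AlgEquiv.toLinearMap_apply,
      map_prod, map_prod]
    simp [translate]
  simp only [hg] at key
  rw [Finset.sum_eq_single α] at key
  · rwa [hcomp α hα.2, if_pos rfl] at key
  · intro β _ hβ
    by_cases h0 : c β = 0
    · rw [h0, TensorProduct.tmul_zero]
    · rw [hcomp β h0, if_neg hβ, TensorProduct.zero_tmul]
  · simp

end translation

section infinitesimal

open DualNumber TrivSqZeroExt

variable {n r p : ℕ} {k V : Type} [Field k] [AddCommGroup V] [Module k V]

/-- The invertible matrix `1 + N` for `N ^ 2 = 0`. -/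
def oneAdd {C : Type} [CommRing C] (N : Matrix (Fin n) (Fin n) C) (h : N * N = 0) : GL (Fin n) C :=
  ⟨1 + N, 1 - N, by noncomm_ring [h], by noncomm_ring [h]⟩

lemma single_mul_single_eq_zero {C : Type} [CommRing C] {z : C} (hz : z * z = 0) (a b : Fin n) :
    Matrix.single a b z * Matrix.single a b z = 0 := by
  by_cases h : b = a
  · subst h
    simp [hz]
  · exact Matrix.single_mul_single_of_ne _ _ _ _ h _

/-- The elementary matrix `1 + z e_{ab}`, where `z ^ 2 = 0`. -/
def elem {C : Type} [CommRing C] {z : C} (hz : z * z = 0) (a b : Fin n) : GL (Fin n) C :=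
  oneAdd (Matrix.single a b z) (single_mul_single_eq_zero hz a b)

variable (ρ : ∀ (B : Type) [CommRing B] [Algebra k B],
      GL (Fin n) B →* ((B ⊗[k] V) ≃ₗ[B] (B ⊗[k] V)))

/-- The action of the matrix unit `e_{ab}` in the Lie algebra representation. -/
noncomputable def lieAct (a b : Fin n) : V →ₗ[k] V :=
  (TensorProduct.lid k V).toLinearMap ∘ₗ (sndHom k k).rTensor V ∘ₗ
    ((ρ k[ε] (elem (eps_mul_eps (R := k)) a b)).toLinearMap.restrictScalars k) ∘ₗ
      TensorProduct.mk k k[ε] V 1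

lemma dual_decomp (y : k[ε] ⊗[k] V) :
    y = 1 ⊗ₜ TensorProduct.lid k V ((fstHom k k k).toLinearMap.rTensor V y) +
      (ε : k[ε]) ⊗ₜ TensorProduct.lid k V ((sndHom k k).rTensor V y) := by
  induction y using TensorProduct.induction_on with
  | zero => simp
  | tmul b v =>
    simp only [LinearMap.rTensor_tmul, TensorProduct.lid_tmul, ← TensorProduct.smul_tmul,
      ← TensorProduct.add_tmul]
    congr 1
    ext <;> simp
  | add s t hs ht =>
    simp only [map_add, TensorProduct.tmul_add]
    conv_lhs => rw [hs, ht]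
    abel

variable {ρ}

lemma elem_eps_apply (hρ : Natural ρ) (a b : Fin n) (v : V) :
    ρ k[ε] (elem (eps_mul_eps (R := k)) a b) (1 ⊗ₜ v) = 1 ⊗ₜ v + ε ⊗ₜ lieAct ρ a b v := by
  conv_lhs => rw [dual_decomp (ρ k[ε] (elem (eps_mul_eps (R := k)) a b) (1 ⊗ₜ v))]
  congr 2
  rw [← hρ.apply_one_tmul (fstHom k k k) (elem (eps_mul_eps (R := k)) a b) 1, map_one]
  · simp
  · intro i j
    simp only [elem, oneAdd, Units.val_one, Matrix.add_apply, map_add, Matrix.one_apply,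
      Matrix.single_apply]
    split_ifs <;> simp

lemma elem_apply (hρ : Natural ρ) {C : Type} [CommRing C] [Algebra k C] {z : C} (hz : z * z = 0)
    (a b : Fin n) (v : V) :
    ρ C (elem hz a b) (1 ⊗ₜ v) = 1 ⊗ₜ v + z ⊗ₜ lieAct ρ a b v := by
  set φ : k[ε] →ₐ[k] C := DualNumber.lift ⟨(Algebra.ofId k C, z), hz, fun _ => Commute.all _ _⟩
  have hφ : φ ε = z := DualNumber.lift_apply_eps _
  rw [hρ.apply_one_tmul φ (elem (eps_mul_eps (R := k)) a b), elem_eps_apply hρ]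
  · simp [hφ]
  · intro i j
    simp only [elem, oneAdd, Matrix.add_apply, map_add, Matrix.one_apply, Matrix.single_apply]
    split_ifs <;> simp [hφ]

lemma column_mul_eq_zero {C : Type} [CommRing C] {z : Fin n → C} (hz : ∀ a b, z a * z b = 0)
    (s t : Finset (Fin n)) (j : Fin n) :
    (∑ a ∈ s, Matrix.single a j (z a)) * (∑ a ∈ t, Matrix.single a j (z a)) = 0 := by
  rw [Finset.sum_mul_sum]
  refine Finset.sum_eq_zero fun a _ => Finset.sum_eq_zero fun b _ => ?_
  by_cases h : j = b
  · subst h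
    simp [hz]
  · exact Matrix.single_mul_single_of_ne _ _ _ _ h _

lemma column_apply (hρ : Natural ρ) {C : Type} [CommRing C] [Algebra k C] {z : Fin n → C}
    (hz : ∀ a b, z a * z b = 0) (s : Finset (Fin n)) (j : Fin n) (v : V) :
    ρ C (oneAdd (∑ a ∈ s, Matrix.single a j (z a)) (column_mul_eq_zero hz s s j)) (1 ⊗ₜ v) =
      1 ⊗ₜ v + ∑ a ∈ s, z a ⊗ₜ lieAct ρ a j v := by
  classical
  induction s using Finset.induction_on generalizing v with
  | empty =>
    have : oneAdd (∑ a ∈ (∅ : Finset (Fin n)), Matrix.single a j (z a))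
        (column_mul_eq_zero hz ∅ ∅ j) = 1 := by
      ext1
      simp [oneAdd]
    rw [this]
    simp
  | insert a s ha ih =>
    have hmul : oneAdd (∑ a ∈ insert a s, Matrix.single a j (z a))
        (column_mul_eq_zero hz _ _ j) =
        oneAdd (∑ a ∈ s, Matrix.single a j (z a)) (column_mul_eq_zero hz s s j) *
          elem (hz a a) a j := by
      apply Units.ext
      have := column_mul_eq_zero hz s {a} j
      rw [Finset.sum_singleton] at this
      rw [Units.val_mul]
      simp only [oneAdd, elem, Finset.sum_insert ha, mul_add, add_mul, this, one_mul, mul_one,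
        add_zero]
      abel
    have hsm : ∀ u : V, z a ⊗ₜ[k] u = z a • ((1 : C) ⊗ₜ[k] u) := fun u => by
      rw [TensorProduct.smul_tmul', smul_eq_mul, mul_one]
    rw [hmul, map_mul, LinearEquiv.mul_apply, elem_apply hρ, map_add, ih, hsm, map_smul, ih,
      smul_add, Finset.smul_sum]
    have h0 : ∑ b ∈ s, z a • z b ⊗ₜ[k] lieAct ρ b j (lieAct ρ a j v) = 0 := by
      refine Finset.sum_eq_zero fun b _ => ?_
      rw [TensorProduct.smul_tmul', smul_eq_mul, hz, TensorProduct.zero_tmul]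
    rw [h0, add_zero, Finset.sum_insert ha, ← hsm]
    abel

/-- The substitution `P ↦ P + ε f ∂_j P`. -/
lemma aeval_add_eps {q : ℕ} (j : Fin n) (f P : MvPolynomial (Fin n) k) :
    aeval (fun i => x k[ε] n q i + if i = j then
      algebraMap k[ε] (Rq k[ε] n q) ε * bc k k[ε] n q (Ideal.Quotient.mk _ f) else 0) P =
      bc k k[ε] n q (Ideal.Quotient.mk _ P) + algebraMap k[ε] (Rq k[ε] n q) ε *
        bc k k[ε] n q (Ideal.Quotient.mk _ (f * pderiv j P)) := by
  have hε : algebraMap k[ε] (Rq k[ε] n q) ε * algebraMap k[ε] (Rq k[ε] n q) ε = 0 := by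
    rw [← map_mul, eps_mul_eps, map_zero]
  induction P using MvPolynomial.induction_on with
  | C a =>
    rw [aeval_C, pderiv_C, mul_zero, map_zero, map_zero, mul_zero, add_zero]
    exact ((bc k k[ε] n q).commutes a).symm
  | add P Q hP hQ => rw [map_add, hP, hQ]; simp only [map_add, mul_add]; ring
  | mul_X P i hP =>
    rw [map_mul, hP, aeval_X]
    simp only [Derivation.leibniz, pderiv_X, smul_eq_mul, map_mul, map_add, mul_add, mk_X, bc_x,
      Pi.single_apply]
    by_cases h : i = j
    · subst h
      simp only [if_true, map_one]
      linear_combination (bc k k[ε] n q (Ideal.Quotient.mk _ f) *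
        bc k k[ε] n q (Ideal.Quotient.mk _ f) * bc k k[ε] n q (Ideal.Quotient.mk _ (pderiv i P))) * hε
    · have h' : j ≠ i := fun e => h e.symm
      simp only [h, if_false, map_zero]
      ring

/-- The images of the coordinates under the infinitesimal automorphism `1 + ε f ∂_j`. -/
noncomputable def shear (q : ℕ) (j : Fin n) (f : MvPolynomial (Fin n) k) (i : Fin n) :
    Rq k[ε] n q :=
  x k[ε] n q i + if i = j then
    algebraMap k[ε] (Rq k[ε] n q) ε * bc k k[ε] n q (Ideal.Quotient.mk _ f) else 0

lemma algebraMap_eps_mul_self {q : ℕ} :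
    algebraMap k[ε] (Rq k[ε] n q) ε * algebraMap k[ε] (Rq k[ε] n q) ε = 0 := by
  rw [← map_mul, eps_mul_eps, map_zero]

lemma lift_shear_bc {q : ℕ} (j : Fin n) (f P : MvPolynomial (Fin n) k)
    (h : ∀ i, shear q j f i ^ q = 0) :
    lift (B := k[ε]) (shear q j f) h (bc k k[ε] n q (Ideal.Quotient.mk _ P)) =
      bc k k[ε] n q (Ideal.Quotient.mk _ P) + algebraMap k[ε] (Rq k[ε] n q) ε *
        bc k k[ε] n q (Ideal.Quotient.mk _ (f * pderiv j P)) := by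
  conv_lhs => rw [bc_mk, lift_mk, aeval_map_algebraMap]
  exact aeval_add_eps j f P

lemma lift_shear_shear {q : ℕ} (j : Fin n) (f g : MvPolynomial (Fin n) k) (hfg : f + g = 0)
    (h : ∀ i, shear q j f i ^ q = 0) (i : Fin n) :
    lift (B := k[ε]) (shear q j f) h (shear q j g i) = x k[ε] n q i := by
  obtain rfl : g = -f := (neg_eq_of_add_eq_zero_right hfg).symm
  conv_lhs => rw [shear]
  rw [map_add, lift_x]
  by_cases hij : i = j
  · rw [if_pos hij, map_mul, AlgHom.commutes, lift_shear_bc, shear, if_pos hij, map_neg, map_neg]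
    linear_combination bc k k[ε] n q (Ideal.Quotient.mk _ (f * pderiv j (-f))) *
      algebraMap_eps_mul_self (k := k) (n := n) (q := q)
  · rw [if_neg hij, map_zero, add_zero, shear, if_neg hij, add_zero]

lemma shear_pow [Fact p.Prime] [CharP k p] (hr : 1 ≤ r) (j : Fin n) (f : MvPolynomial (Fin n) k)
    (i : Fin n) : shear (p ^ r) j f i ^ p ^ r = 0 := by
  have hp : 2 ≤ p ^ r :=
    (Fact.out : p.Prime).two_le.trans (Nat.le_self_pow (Nat.one_le_iff_ne_zero.1 hr) p)
  rw [shear, add_pow_eq (k := k), x_pow, zero_add]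
  split_ifs
  · refine pow_eq_zero_of_le hp ?_
    rw [mul_pow, pow_two, algebraMap_eps_mul_self, zero_mul]
  · exact zero_pow (by omega)

/-- The infinitesimal automorphism `1 + ε f ∂_j`. -/
noncomputable def shearAut (p : ℕ) [Fact p.Prime] [CharP k p] (hr : 1 ≤ r) (j : Fin n)
    (f : MvPolynomial (Fin n) k) : Rq k[ε] n (p ^ r) ≃ₐ[k[ε]] Rq k[ε] n (p ^ r) :=
  equivOf (shear _ j f) (shear _ j (-f)) (shear_pow hr j f) (shear_pow hr j _)
    (lift_shear_shear j _ _ (add_neg_cancel f) _) (lift_shear_shear j _ _ (neg_add_cancel f) _)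

lemma shear_column_mul {q : ℕ} (f : MvPolynomial (Fin n) k) (a b : Fin n) :
    algebraMap k[ε] (Rq k[ε] n q) ε * bc k k[ε] n q (Ideal.Quotient.mk _ (pderiv a f)) *
      (algebraMap k[ε] (Rq k[ε] n q) ε * bc k k[ε] n q (Ideal.Quotient.mk _ (pderiv b f))) = 0 := by
  rw [mul_mul_mul_comm, algebraMap_eps_mul_self, zero_mul]

lemma isJacobian_shearAut [Fact p.Prime] [CharP k p] (hr : 1 ≤ r) (j : Fin n)
    (f : MvPolynomial (Fin n) k) : IsJacobian (shearAut p hr j f)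
      (oneAdd _ (column_mul_eq_zero (shear_column_mul f) Finset.univ Finset.univ j)) := by
  refine ⟨fun i => X i + if i = j then C ε * MvPolynomial.map (algebraMap k k[ε]) f else 0,
    fun i => ?_, fun a b => ?_⟩
  · rw [shearAut, equivOf_apply, lift_x, shear, map_add, mk_X, bc_mk]
    congr 1
    split_ifs
    · rw [map_mul]
      rfl
    · rw [map_zero]
  · simp only [oneAdd, Matrix.add_apply, Matrix.sum_apply, map_add, Matrix.one_apply,
      Matrix.single_apply, pderiv_X, Pi.single_apply, bc_mk]
    congr 1
    · split_ifs <;> simp_all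
    · by_cases h : b = j
      · subst h
        simp only [and_true, if_true, Finset.sum_ite_eq', Finset.mem_univ, Derivation.leibniz,
          pderiv_C, smul_eq_mul, pderiv_map, mul_zero, add_zero]
        rfl
      · have h' : j ≠ b := fun e => h e.symm
        simp [h, h']

/-- An invariant subspace is stable under the Lie algebra of derivations. -/
lemma lie_mem [Fact p.Prime] [CharP k p] (hr : 1 ≤ r) (hρ : Natural ρ)
    {W : Submodule k (Rq k n (p ^ r) ⊗[k] V)} (hW : Invariant ρ W) (f P : MvPolynomial (Fin n) k)
    (j : Fin n) (v : V) (h : (Ideal.Quotient.mk _ P : Rq k n (p ^ r)) ⊗ₜ[k] v ∈ W) :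
    (Ideal.Quotient.mk _ (f * pderiv j P) : Rq k n (p ^ r)) ⊗ₜ[k] v +
      ∑ a, (Ideal.Quotient.mk _ (P * pderiv a f) : Rq k n (p ^ r)) ⊗ₜ[k] lieAct ρ a j v ∈ W := by
  have key := hW k[ε] (shearAut p hr j f) _ (isJacobian_shearAut hr j f) _
    (Submodule.subset_span ⟨_, h, rfl⟩) (sndHom k k)
  rw [LinearMap.rTensor_tmul, LinearMap.rTensor_tmul, LinearMap.restrictScalars_apply,
    AlgEquiv.toLinearMap_apply, AlgHom.toLinearMap_apply, shearAut, equivOf_apply,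
    lift_shear_bc] at key
  set G : Rq k[ε] n (p ^ r) := bc k k[ε] n (p ^ r) (Ideal.Quotient.mk _ P) +
    algebraMap k[ε] (Rq k[ε] n (p ^ r)) ε *
      bc k k[ε] n (p ^ r) (Ideal.Quotient.mk _ (f * pderiv j P)) with hG
  have hsm : G ⊗ₜ[k] v = G • ((1 : Rq k[ε] n (p ^ r)) ⊗ₜ[k] v) := by
    rw [TensorProduct.smul_tmul', smul_eq_mul, mul_one]
  rw [hsm, map_smul, column_apply hρ (shear_column_mul f), smul_add, ← hsm, Finset.smul_sum] at key
  have h1 : coeffMap n (p ^ r) (sndHom k k) G = Ideal.Quotient.mk _ (f * pderiv j P) := by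
    have : G = (1 : k[ε]) • bc k k[ε] n (p ^ r) (Ideal.Quotient.mk _ P) +
        (ε : k[ε]) • bc k k[ε] n (p ^ r) (Ideal.Quotient.mk _ (f * pderiv j P)) := by
      rw [smul_eq, smul_eq, map_one, one_mul]
    rw [this, map_add, coeffMap_smul_bc, coeffMap_smul_bc]
    simp
  have h2 : ∀ a, coeffMap n (p ^ r) (sndHom k k) (G * (algebraMap k[ε] (Rq k[ε] n (p ^ r)) ε *
      bc k k[ε] n (p ^ r) (Ideal.Quotient.mk _ (pderiv a f)))) =
      Ideal.Quotient.mk _ (P * pderiv a f) := by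
    intro a
    have : G * (algebraMap k[ε] (Rq k[ε] n (p ^ r)) ε *
        bc k k[ε] n (p ^ r) (Ideal.Quotient.mk _ (pderiv a f))) =
        (ε : k[ε]) • bc k k[ε] n (p ^ r) (Ideal.Quotient.mk _ (P * pderiv a f)) := by
      rw [smul_eq, map_mul _ P, map_mul, hG]
      linear_combination (bc k k[ε] n (p ^ r) (Ideal.Quotient.mk _ (f * pderiv j P)) *
        bc k k[ε] n (p ^ r) (Ideal.Quotient.mk _ (pderiv a f))) *
        algebraMap_eps_mul_self (k := k) (n := n) (q := p ^ r)
    rw [this, coeffMap_smul_bc]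
    simp
  simp only [map_add, map_sum, TensorProduct.smul_tmul', smul_eq_mul, LinearMap.rTensor_tmul,
    h1, h2] at key
  exact key

/-- A highest weight vector of weight `lam`, for the actions of the diagonal and of the
upper unitriangular matrices. -/
def IsHighestWeight (ρ : ∀ (B : Type) [CommRing B] [Algebra k B],
      GL (Fin n) B →* ((B ⊗[k] V) ≃ₗ[B] (B ⊗[k] V))) (lam : Fin n → ℤ) (v : V) : Prop :=
  (∀ (B : Type) [CommRing B] [Algebra k B],
    ∀ (t : Fin n → Bˣ) (M : GL (Fin n) B),
      (M : Matrix (Fin n) (Fin n) B) = Matrix.diagonal (fun i => (t i : B)) →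
      ρ B M ((1 : B) ⊗ₜ[k] v) = (∏ i, t i ^ lam i) • ((1 : B) ⊗ₜ[k] v)) ∧
  (∀ (B : Type) [CommRing B] [Algebra k B], ∀ M : GL (Fin n) B,
    (∀ a b : Fin n, b < a → (M : Matrix (Fin n) (Fin n) B) a b = 0) →
    (∀ a, (M : Matrix (Fin n) (Fin n) B) a a = 1) →
    ρ B M ((1 : B) ⊗ₜ[k] v) = (1 : B) ⊗ₜ[k] v)

lemma eps_tmul_injective {u v : V} (h : (ε : k[ε]) ⊗ₜ[k] u = (ε : k[ε]) ⊗ₜ[k] v) : u = v := by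
  have := congrArg (fun y => TensorProduct.lid k V ((sndHom k k).rTensor V y)) h
  simpa using this

lemma IsHighestWeight.lieAct_of_lt (hρ : Natural ρ) {lam : Fin n → ℤ} {v : V}
    (hv : IsHighestWeight ρ lam v) {i j : Fin n} (hij : i < j) : lieAct ρ i j v = 0 := by
  have h := hv.2 k[ε] (elem (eps_mul_eps (R := k)) i j) (fun a b hab => ?_) (fun a => ?_)
  · rw [elem_eps_apply hρ, add_eq_left] at h
    exact eps_tmul_injective (h.trans (TensorProduct.tmul_zero _ _).symm)
  · have : ¬ (i = a ∧ j = b) := fun e => absurd hij (by rw [e.1, e.2]; exact hab.not_gt)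
    simp [elem, oneAdd, hab.ne', this]
  · have : ¬ (i = a ∧ j = a) := fun e => hij.ne (e.1.trans e.2.symm)
    simp [elem, oneAdd, this]

/-- The unit `1 + ε`. -/
def oneAddEps (k : Type) [Field k] : k[ε]ˣ :=
  ⟨1 + ε, 1 - ε, by ring_nf; simp, by ring_nf; simp⟩

lemma oneAddEps_zpow (m : ℤ) :
    ((oneAddEps k ^ m : k[ε]ˣ) : k[ε]) = 1 + algebraMap k k[ε] m * ε := by
  have h := eps_mul_eps (R := k)
  induction m using Int.induction_on with
  | zero => simp
  | succ m ih =>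
    rw [zpow_add_one, Units.val_mul, ih]
    simp only [oneAddEps, Int.cast_add, Int.cast_one, map_add, map_one]
    linear_combination algebraMap k k[ε] ((m : ℤ) : k) * h
  | pred m ih =>
    rw [zpow_sub_one, Units.val_mul, ih]
    have : ((oneAddEps k)⁻¹ : k[ε]ˣ).val = 1 - ε := rfl
    rw [this]
    simp only [Int.cast_sub, Int.cast_one, map_sub, map_one]
    linear_combination -algebraMap k k[ε] ((-(m : ℤ) : ℤ) : k) * h

lemma IsHighestWeight.lieAct_self (hρ : Natural ρ) {lam : Fin n → ℤ} {v : V}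
    (hv : IsHighestWeight ρ lam v) (i : Fin n) : lieAct ρ i i v = (lam i : k) • v := by
  have h := hv.1 k[ε] (fun l => if l = i then oneAddEps k else 1)
    (elem (eps_mul_eps (R := k)) i i) ?_
  · rw [elem_eps_apply hρ, Finset.prod_eq_single i, if_pos rfl, Units.smul_def, oneAddEps_zpow,
      add_smul, one_smul, add_right_inj, TensorProduct.smul_tmul', smul_eq_mul, mul_one,
      ← Algebra.smul_def, TensorProduct.smul_tmul] at h
    · exact eps_tmul_injective h
    · intro l _ hl
      rw [if_neg hl, one_zpow]
    · simp
  · ext1 a b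
    simp only [elem, oneAdd, Matrix.add_apply, Matrix.one_apply, Matrix.single_apply,
      Matrix.diagonal_apply]
    by_cases hab : a = b
    · subst hab
      by_cases hai : a = i
      · subst hai
        simp [oneAddEps]
      · have : i ≠ a := fun e => hai e.symm
        simp [hai, this]
    · have : ¬ (i = a ∧ i = b) := fun e => hab (e.1.symm.trans e.2)
      simp [hab, this]

/-- If `1 ⊗ v ∈ W` for a highest weight vector `v` of non-exceptional weight,
then `R ⊗ v ⊆ W`. -/
lemma tmul_mem_of_isHighestWeight [Fact p.Prime] [CharP k p] (hp2 : p ≠ 2) (hr : 1 ≤ r)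
    (hρ : Natural ρ) {W : Submodule k (Rq k n (p ^ r) ⊗[k] V)} (hW : Invariant ρ W)
    {lam : Fin n → ℤ} {v : V} (hv : IsHighestWeight ρ lam v) {i j : Fin n} (hij : i ≤ j)
    (hj : (lam j : k) ≠ 0) (hi : (lam i : k) ≠ 1)
    (h1 : (1 : Rq k n (p ^ r)) ⊗ₜ[k] v ∈ W) (F : Rq k n (p ^ r)) : F ⊗ₜ[k] v ∈ W := by
  obtain ⟨F, rfl⟩ := Ideal.Quotient.mk_surjective F
  rw [← map_one (Ideal.Quotient.mk _)] at h1
  have hx : (x k n (p ^ r) i) ⊗ₜ[k] v ∈ W := by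
    have h := lie_mem hr hρ hW (X i * X j) 1 j v h1
    have hs : ∀ a, (Ideal.Quotient.mk _ (1 * pderiv a (X i * X j)) : Rq k n (p ^ r)) ⊗ₜ[k]
        lieAct ρ a j v = (if a = j then x k n (p ^ r) i ⊗ₜ[k] lieAct ρ a j v else 0) +
          if a = i then x k n (p ^ r) j ⊗ₜ[k] lieAct ρ a j v else 0 := by
      intro a
      rw [one_mul, Derivation.leibniz, pderiv_X, pderiv_X, map_add, TensorProduct.add_tmul]
      congr 1
      · by_cases e : a = j
        · subst e; simp [mk_X]
        · simp [e, Ne.symm e]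
      · by_cases e : a = i
        · subst e; simp [mk_X]
        · simp [e, Ne.symm e]
    simp only [hs, Finset.sum_add_distrib, Finset.sum_ite_eq', Finset.mem_univ, if_true,
      pderiv_one, mul_zero, map_zero, TensorProduct.zero_tmul, zero_add] at h
    rw [hv.lieAct_self hρ] at h
    rcases hij.eq_or_lt with rfl | hlt
    · rw [hv.lieAct_self hρ, ← TensorProduct.tmul_add, ← two_smul k, smul_smul,
        TensorProduct.tmul_smul] at h
      refine (Submodule.smul_mem_iff _ (mul_ne_zero ?_ hj)).1 h
      exact Ring.two_ne_zero (by rwa [ringChar.eq k p])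
    · rw [hv.lieAct_of_lt hρ hlt, TensorProduct.tmul_zero, add_zero, TensorProduct.tmul_smul] at h
      exact (Submodule.smul_mem_iff _ hj).1 h
  have h2 := lie_mem hr hρ hW F (X i) i v hx
  have h3 := lie_mem hr hρ hW (F * X i) 1 i v h1
  have hs : ∀ a, (Ideal.Quotient.mk _ (1 * pderiv a (F * X i)) : Rq k n (p ^ r)) ⊗ₜ[k]
      lieAct ρ a i v =
        (if a = i then (Ideal.Quotient.mk _ F : Rq k n (p ^ r)) ⊗ₜ[k] lieAct ρ a i v else 0) +
          (Ideal.Quotient.mk _ (X i * pderiv a F) : Rq k n (p ^ r)) ⊗ₜ[k] lieAct ρ a i v := by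
    intro a
    rw [one_mul, Derivation.leibniz, pderiv_X, map_add, TensorProduct.add_tmul, smul_eq_mul,
      smul_eq_mul]
    congr 1
    by_cases e : a = i
    · subst e; simp
    · simp [e, Ne.symm e]
  simp only [hs, Finset.sum_add_distrib, Finset.sum_ite_eq', Finset.mem_univ, if_true,
    pderiv_one, mul_zero, map_zero, TensorProduct.zero_tmul, zero_add, hv.lieAct_self hρ] at h3
  rw [pderiv_X_self, mul_one] at h2
  have h4 := Submodule.sub_mem _ h2 h3
  rw [add_sub_add_right_eq_sub, TensorProduct.tmul_smul] at h4
  nth_rewrite 1 [← one_smul k ((Ideal.Quotient.mk _ F : Rq k n (p ^ r)) ⊗ₜ[k] v)] at h4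
  rw [← sub_smul] at h4
  exact (Submodule.smul_mem_iff _ (sub_ne_zero.2 hi.symm)).1 h4

end infinitesimal

/-- If `r(lam)` is neither zero nor a fundamental weight, then `lam` is not of the form
`(1, ..., 1, 0, ..., 0)` modulo `p`. -/
lemma exists_cast_ne {n p : ℕ} (k : Type) [Field k] [Fact p.Prime] [CharP k p] (lam : Fin n → ℤ)
    (hr0 : rlam p n lam ≠ 0)
    (hrfund : ¬ ∃ i0 : Fin n, rlam p n lam = fun j => if j ≤ i0 then (1 : ℤ) else 0) :
    ∃ i j : Fin n, i ≤ j ∧ (lam j : k) ≠ 0 ∧ (lam i : k) ≠ 1 := by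
  classical
  by_contra! hcon
  have hmod : ∀ a b : ℤ, (a : k) = b → a % p = b % p := fun a b h =>
    (CharP.intCast_eq_intCast k p).1 h
  have hp1 : (1 : ℤ) % p = 1 := Int.emod_eq_of_lt (by norm_num)
    (by exact_mod_cast (Fact.out : p.Prime).one_lt)
  by_cases hex : ∃ j, (lam j : k) ≠ 0
  · obtain ⟨i0, hi0, hmax⟩ := Finset.exists_max_image
      (Finset.univ.filter fun j => (lam j : k) ≠ 0) id
      (by obtain ⟨j, hj⟩ := hex; exact ⟨j, by simpa using hj⟩)
    simp only [Finset.mem_filter, Finset.mem_univ, true_and, id] at hi0 hmax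
    have hle : ∀ i ≤ i0, (lam i : k) = 1 := fun i hi => hcon i i0 hi hi0
    have hgt : ∀ i, i0 < i → (lam i : k) = 0 := fun i hi => by
      by_contra h
      exact absurd (hmax i h) hi.not_ge
    have hm : ∀ j, mcoef p n lam j = if j = i0 then 1 else 0 := by
      intro j
      have hcast : ((lam j - lamSucc n lam j : ℤ) : k) = ((if j = i0 then 1 else 0 : ℤ) : k) := by
        rw [Int.cast_sub]
        rcases lt_trichotomy j i0 with h | h | h
        · have hn : (j : ℕ) + 1 < n := lt_of_le_of_lt (Nat.succ_le_of_lt h) i0.2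
          rw [lamSucc, dif_pos hn, hle j h.le, hle _ (Fin.le_def.2 (Nat.succ_le_of_lt h)),
            if_neg h.ne]
          simp
        · subst h
          rw [hle j le_rfl, lamSucc, if_pos rfl]
          split_ifs with hn
          · rw [hgt _ (Fin.lt_def.2 (Nat.lt_succ_self _))]
            simp
          · simp
        · rw [hgt j h, lamSucc, if_neg h.ne']
          split_ifs with hn
          · rw [hgt _ (h.trans (Fin.lt_def.2 (Nat.lt_succ_self _)))]
            simp
          · simp
      rw [mcoef, hmod _ _ hcast]
      split_ifs
      · exact hp1
      · exact Int.zero_emod _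
    refine hrfund ⟨i0, funext fun i => ?_⟩
    simp only [rlam, hm]
    rw [Finset.sum_ite_eq']
    simp
  · push Not at hex
    refine hr0 (funext fun i => Finset.sum_eq_zero fun j _ => ?_)
    have hcast : ((lam j - lamSucc n lam j : ℤ) : k) = ((0 : ℤ) : k) := by
      rw [Int.cast_sub, hex, lamSucc]
      split_ifs <;> simp [hex]
    rw [mcoef, hmod _ _ hcast, Int.zero_emod]

end Rq

set_option synthInstance.maxHeartbeats 1000000 in
set_option maxHeartbeats 4000000 in
/-- Assume `char k = p > 2`.  Let `λ` be a dominant weight of `GL_n`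
whose mod-`p` reduction `r(λ)` is neither `0` nor a fundamental weight
`ε_1+...+ε_i`.  Then `L(λ, G(n,r)) = I(L(λ)) = R(n,r) ⊗ L(λ)`, i.e. the induced
module `I(L(λ))` is an irreducible `G(n,r)`-representation.

Formalization via functors of points: an algebraic representation is given by
compatible (natural) actions on the `B`-points for all commutative `k`-algebras `B`;
`Vλ = L(λ)` is an irreducible algebraic `GL_n`-representation of highest weight `λ`
(hypotheses `hnat`, `hirr`, `hhw`), `ρI` is the `G(n,r)`-action on
`I(L(λ)) = R(n,r) ⊗ L(λ)` given by `g(f ⊗ v) = (∂g(x_s)/∂x_j)_{js}·(g(f) ⊗ v)`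
(hypothesis `hform`), and the conclusion says that the only `G(n,r)`-invariant
subspaces of `R(n,r) ⊗ L(λ)` (invariance being tested on all points) are `0` and
everything. -/
theorem stmt_13 (k : Type) [Field k] (p : ℕ) [Fact p.Prime] [CharP k p] (hp2 : p ≠ 2)
    (n r : ℕ) (hn : 1 ≤ n) (hr : 1 ≤ r)
    (lam : Fin n → ℤ) (hdom : ∀ i j : Fin n, i ≤ j → lam j ≤ lam i)
    (hr0 : rlam p n lam ≠ 0)
    (hrfund : ¬ ∃ i0 : Fin n, rlam p n lam = fun j => if j ≤ i0 then (1 : ℤ) else 0)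
    (Vl : Type) [AddCommGroup Vl] [Module k Vl] [FiniteDimensional k Vl]
    (ρ : ∀ (B : Type) [CommRing B] [Algebra k B],
      GL (Fin n) B →* ((B ⊗[k] Vl) ≃ₗ[B] (B ⊗[k] Vl)))
    (hnat : ∀ (B C : Type) [CommRing B] [Algebra k B] [CommRing C] [Algebra k C],
      ∀ (φ : B →ₐ[k] C) (M : GL (Fin n) B) (M' : GL (Fin n) C),
        (∀ a b, (M' : Matrix (Fin n) (Fin n) C) a b = φ ((M : Matrix (Fin n) (Fin n) B) a b)) →
        ∀ x, ρ C M' (TensorProduct.map φ.toLinearMap LinearMap.id x) =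
          TensorProduct.map φ.toLinearMap LinearMap.id (ρ B M x))
    (hirr : ∀ W : Submodule k Vl,
      (∀ (B : Type) [CommRing B] [Algebra k B],
        ∀ (M : GL (Fin n) B) (w : B ⊗[k] Vl),
          w ∈ Submodule.span B (⇑(TensorProduct.mk k B Vl 1) '' (W : Set Vl)) →
          ρ B M w ∈ Submodule.span B (⇑(TensorProduct.mk k B Vl 1) '' (W : Set Vl))) →
      W = ⊥ ∨ W = ⊤)
    (hhw : ∃ v : Vl, v ≠ 0 ∧
      (∀ (B : Type) [CommRing B] [Algebra k B],
        ∀ (t : Fin n → Bˣ) (M : GL (Fin n) B),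
          (M : Matrix (Fin n) (Fin n) B) = Matrix.diagonal (fun i => (t i : B)) →
          ρ B M ((1 : B) ⊗ₜ[k] v) = (∏ i, t i ^ lam i) • ((1 : B) ⊗ₜ[k] v)) ∧
      (∀ (B : Type) [CommRing B] [Algebra k B], ∀ M : GL (Fin n) B,
        (∀ a b : Fin n, b < a → (M : Matrix (Fin n) (Fin n) B) a b = 0) →
        (∀ a, (M : Matrix (Fin n) (Fin n) B) a a = 1) →
        ρ B M ((1 : B) ⊗ₜ[k] v) = (1 : B) ⊗ₜ[k] v))
    (ρI : ∀ (B : Type) [CommRing B] [Algebra k B],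
      (Rq B n (p ^ r) ≃ₐ[B] Rq B n (p ^ r)) →*
        ((Rq B n (p ^ r) ⊗[k] Vl) ≃ₗ[B] (Rq B n (p ^ r) ⊗[k] Vl)))
    (hform : ∀ (B : Type) [CommRing B] [Algebra k B],
      ∀ (g : Rq B n (p ^ r) ≃ₐ[B] Rq B n (p ^ r)) (Pg : Fin n → MvPolynomial (Fin n) B),
        (∀ j, Ideal.Quotient.mk _ (Pg j) = g (Ideal.Quotient.mk _ (X j))) →
        ∀ J : GL (Fin n) (Rq B n (p ^ r)),
          (∀ a b, (J : Matrix (Fin n) (Fin n) (Rq B n (p ^ r))) a b =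
            Ideal.Quotient.mk _ (pderiv a (Pg b))) →
          ∀ (P : MvPolynomial (Fin n) B) (v : Vl),
            ρI B g (Ideal.Quotient.mk _ P ⊗ₜ[k] v) =
              ρ (Rq B n (p ^ r)) J (g (Ideal.Quotient.mk _ P) ⊗ₜ[k] v)) :
    ∀ W : Submodule k ((Rq k n (p ^ r)) ⊗[k] Vl),
      (∀ (B : Type) [CommRing B] [Algebra k B],
        ∀ θ : ((Rq k n (p ^ r)) ⊗[k] Vl) →ₗ[k] ((Rq B n (p ^ r)) ⊗[k] Vl),
          (∀ (P : MvPolynomial (Fin n) k) (v : Vl),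
            θ (Ideal.Quotient.mk _ P ⊗ₜ[k] v) =
              Ideal.Quotient.mk _ (MvPolynomial.map (algebraMap k B) P) ⊗ₜ[k] v) →
          ∀ (g : Rq B n (p ^ r) ≃ₐ[B] Rq B n (p ^ r)) (w : (Rq B n (p ^ r)) ⊗[k] Vl),
            w ∈ Submodule.span B (⇑θ '' (W : Set _)) →
            ρI B g w ∈ Submodule.span B (⇑θ '' (W : Set _))) →
      W = ⊥ ∨ W = ⊤ := by
  intro W hWinv
  have hρ : Rq.Natural ρ := hnat
  have hI : Rq.Invariant ρ W := by
    rintro B _ _ g J ⟨Pg, hPg, hJ⟩ z hz φ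
    have hact : ∀ z, ρI B g z =
        ρ (Rq B n (p ^ r)) J ((g.toLinearMap.restrictScalars k).rTensor Vl z) := by
      intro z
      induction z using TensorProduct.induction_on with
      | zero => simp
      | tmul f v =>
        obtain ⟨P, rfl⟩ := Ideal.Quotient.mk_surjective f
        exact hform B g Pg hPg J hJ P v
      | add s t hs ht => simp only [map_add, hs, ht]
    rw [← hact]
    refine Rq.coeffMap_mem W (hWinv B ((Rq.bc k B n (p ^ r)).toLinearMap.rTensor Vl) ?_ g z hz) φ
    intro P v
    rw [LinearMap.rTensor_tmul, AlgHom.toLinearMap_apply, Rq.bc_mk]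
  by_cases hW : W = ⊥
  · exact Or.inl hW
  right
  obtain ⟨u, hu, huW⟩ := Rq.exists_one_tmul_mem hI hW
  obtain ⟨v, hv0, hv⟩ := hhw
  obtain ⟨i, j, hij, hj, hi⟩ := Rq.exists_cast_ne k lam hr0 hrfund
  have hone : W.comap (TensorProduct.mk k (Rq k n (p ^ r)) Vl 1) = ⊤ := by
    refine (hirr _ (Rq.stable_of_invariant hρ hI {1} ?_ _ fun v => by simp)).resolve_left fun h => ?_
    · rintro B _ _ g F rfl
      rw [map_one, map_one]
      exact Submodule.subset_span ⟨1, rfl, map_one _⟩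
    · exact hu ((Submodule.mem_bot k).1 (h ▸ huW))
  have hvW : (1 : Rq k n (p ^ r)) ⊗ₜ[k] v ∈ W := by
    have : v ∈ W.comap (TensorProduct.mk k (Rq k n (p ^ r)) Vl 1) := hone ▸ Submodule.mem_top
    exact this
  have hFv := Rq.tmul_mem_of_isHighestWeight hp2 hr hρ hI hv hij hj hi hvW
  have hall : (⨅ F, W.comap (TensorProduct.mk k (Rq k n (p ^ r)) Vl F)) = ⊤ := by
    refine (hirr _ (Rq.stable_of_invariant hρ hI Set.univ ?_ _ fun v => by simp)).resolve_left
      fun h => ?_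
    · intro B _ _ g F _
      rw [Set.image_univ, Rq.span_range_bc]
      exact Submodule.mem_top
    · refine hv0 ((Submodule.mem_bot k).1 (h ▸ ?_))
      simpa using hFv
  rw [eq_top_iff]
  rintro z -
  induction z using TensorProduct.induction_on with
  | zero => exact W.zero_mem
  | add s t hs ht => exact W.add_mem hs ht
  | tmul f w =>
    have : w ∈ ⨅ F, W.comap (TensorProduct.mk k (Rq k n (p ^ r)) Vl F) := hall ▸ Submodule.mem_top
    rw [Submodule.mem_iInf] at this
    exact this f
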